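/- Let M be a {U_{2,5}, U_{3,5}}-fragile matroid with at least 8 elements. If S is a triangle or a 4-element segment of M such that E(M)−S is not a series class or a parallel class of M, then S is coindependent in M. Dually, if C is a triad or a 4-element cosegment of M such that E(M)−C is not a series class or a parallel class of M, then C is independent in M. -/

import Mathlib

open Matroid Set
open scoped Classical

namespace Relax

variable {α β : Type*}

/-- A circuit of a matroid: a minimal dependent set. -/
def Circuit (M : Matroid α) (C : Set α) : Prop :=
  M.Dep C ∧ ∀ D ⊂ C, M.Indep D

/-- A hyperplane of a matroid: a maximal proper flat. -/
def Hyperplane (M : Matroid α) (H : Set α) : Prop :=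
  M.IsFlat H ∧ H ≠ M.E ∧ ∀ F, M.IsFlat F → H ⊂ F → F = M.E

/-- `X` is a circuit-hyperplane of `M`. -/
def CircuitHyperplane (M : Matroid α) (X : Set α) : Prop :=
  Circuit M X ∧ Hyperplane M X

/-- `M'` is obtained from `M` by relaxing the circuit-hyperplane `X` : the ground set is
unchanged and the bases of `M'` are exactly the bases of `M` together with `X`. -/
def IsRelaxation (M M' : Matroid α) (X : Set α) : Prop :=
  CircuitHyperplane M X ∧ M'.E = M.E ∧ ∀ B, (M'.IsBase B ↔ M.IsBase B ∨ B = X)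

/-- A matroid is representable over a field `F` if there is an assignment of vectors to its
elements under which independence coincides with linear independence. -/
def Representable (M : Matroid α) (F : Type*) [Field F] : Prop :=
  ∃ (n : ℕ) (φ : α → (Fin n → F)), ∀ I ⊆ M.E,
    (M.Indep I ↔ LinearIndependent F (fun x : I => φ (x : α)))

/-- The field GF(4). -/
abbrev GF4 := GaloisField 2 2

/-- The rank of a set in a matroid: the maximum size of an independent subset. -/
noncomputable def rk (M : Matroid α) (X : Set α) : ℕ :=
  sSup {n | ∃ I, M.Indep I ∧ I ⊆ X ∧ I.ncard = n}

/-- Deletion of a set of elements. -/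
def delete (M : Matroid α) (D : Set α) : Matroid α := M ↾ (M.E \ D)

/-- Contraction of a set of elements. -/
def contract (M : Matroid α) (C : Set α) : Matroid α := (delete M✶ C)✶

/-- `N` is a minor of `M`. -/
def MinorOf (N M : Matroid α) : Prop :=
  ∃ C D, C ⊆ M.E ∧ D ⊆ M.E ∧ Disjoint C D ∧ N = delete (contract M C) D

/-- Isomorphism of matroids. -/
def Iso (M : Matroid α) (N : Matroid β) : Prop :=
  ∃ e : M.E ≃ N.E, ∀ I : Set M.E,
    M.Indep ((↑) '' I) ↔ N.Indep ((↑) '' (e '' I))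

/-- `M` has a minor isomorphic to `N`. -/
def HasMinorIso (M : Matroid α) (N : Matroid β) : Prop :=
  ∃ M₀ : Matroid α, MinorOf M₀ M ∧ Iso M₀ N

/-- `M` has a minor isomorphic to a member of the set `𝒩` of matroids. -/
def HasMinorIn (M : Matroid α) (𝒩 : Set (Matroid β)) : Prop :=
  ∃ N ∈ 𝒩, HasMinorIso M N

/-- `M` is `𝒩`-fragile. -/
def Fragile (M : Matroid α) (𝒩 : Set (Matroid β)) : Prop :=
  HasMinorIn M 𝒩 ∧
    ∀ a ∈ M.E, ¬ (HasMinorIn (delete M {a}) 𝒩 ∧ HasMinorIn (contract M {a}) 𝒩)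

/-- `M` is (isomorphic to) the uniform matroid `U_{r,n}`. -/
def IsUniform (M : Matroid α) (r n : ℕ) : Prop :=
  M.E.Finite ∧ M.E.ncard = n ∧ ∀ I ⊆ M.E, (M.Indep I ↔ I.ncard ≤ r)

/-- `M` has a minor isomorphic to `U_{r,n}`. -/
def HasUnifMinor (M : Matroid α) (r n : ℕ) : Prop :=
  ∃ M₀, MinorOf M₀ M ∧ IsUniform M₀ r n

/-- `M` has a `{U_{2,5}, U_{3,5}}`-minor. -/
def HasU25U35Minor (M : Matroid α) : Prop :=
  HasUnifMinor M 2 5 ∨ HasUnifMinor M 3 5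

/-- `M` is `U_{2,4}`-fragile. -/
def FragileU24 (M : Matroid α) : Prop :=
  HasUnifMinor M 2 4 ∧
    ∀ a ∈ M.E, ¬ (HasUnifMinor (delete M {a}) 2 4 ∧ HasUnifMinor (contract M {a}) 2 4)

/-- `M` is `{U_{2,5}, U_{3,5}}`-fragile. -/
def FragileU25U35 (M : Matroid α) : Prop :=
  HasU25U35Minor M ∧
    ∀ a ∈ M.E, ¬ (HasU25U35Minor (delete M {a}) ∧ HasU25U35Minor (contract M {a}))

/-- A loop. -/
def Loop (M : Matroid α) (x : α) : Prop := x ∈ M.E ∧ ¬ M.Indep {x}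

/-- Two distinct non-loop elements are parallel if they form a two-element circuit. -/
def Parallel (M : Matroid α) (x y : α) : Prop := x ≠ y ∧ Circuit M {x, y}

/-- A parallel class: a maximal set of pairwise-parallel non-loop elements. -/
def ParallelClass (M : Matroid α) (A : Set α) : Prop :=
  A ⊆ M.E ∧ (∀ x ∈ A, ¬ Loop M x) ∧
    (∀ x ∈ A, ∀ y ∈ A, x ≠ y → Parallel M x y) ∧
    (∀ B, A ⊆ B → B ⊆ M.E → (∀ x ∈ B, ¬ Loop M x) →
      (∀ x ∈ B, ∀ y ∈ B, x ≠ y → Parallel M x y) → B = A)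

/-- A series class: a parallel class of the dual. -/
def SeriesClass (M : Matroid α) (A : Set α) : Prop := ParallelClass M✶ A

/-- A matroid is connected if every two distinct elements lie in a common circuit. -/
def Connected (M : Matroid α) : Prop :=
  ∀ x ∈ M.E, ∀ y ∈ M.E, x ≠ y → ∃ C, Circuit M C ∧ x ∈ C ∧ y ∈ C

/-- A `k`-separation of `M`. -/
def Separation (M : Matroid α) (k : ℕ) (A B : Set α) : Prop :=
  A ∪ B = M.E ∧ Disjoint A B ∧ k ≤ A.ncard ∧ k ≤ B.ncard ∧
    rk M A + rk M B ≤ rk M M.E + (k - 1)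

/-- A matroid is 3-connected if it is connected and has no 2-separation. -/
def ThreeConnected (M : Matroid α) : Prop :=
  Connected M ∧ ∀ A B, ¬ Separation M 2 A B

/-- `M` is 3-connected up to series and parallel classes. -/
def ThreeConnUpToSP (M : Matroid α) : Prop :=
  Connected M ∧ ∀ A B, Separation M 2 A B →
    (SeriesClass M A ∨ ParallelClass M A ∨ SeriesClass M B ∨ ParallelClass M B)

/-- A 3-separating set of `M`. -/
def ThreeSeparating (M : Matroid α) (Y : Set α) : Prop :=
  Y ⊆ M.E ∧ rk M Y + rk M (M.E \ Y) ≤ rk M M.E + 2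

/-- `M` has path width 3: there is an ordering of the ground set all of whose initial
segments are 3-separating. -/
def PathWidth3 (M : Matroid α) : Prop :=
  ∃ (n : ℕ) (e : Fin n → α), Function.Injective e ∧ Set.range e = M.E ∧
    ∀ t : Fin n, ThreeSeparating M (e '' {i | i ≤ t})

/-- A segment: every 3-element subset is a triangle. -/
def Segment (M : Matroid α) (S : Set α) : Prop :=
  S ⊆ M.E ∧ ∀ T ⊆ S, T.ncard = 3 → Circuit M T

/-- A triangle: a 3-element circuit. -/
def Triangle (M : Matroid α) (S : Set α) : Prop := Circuit M S ∧ S.ncard = 3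

/-! ### Reduced representations `[I | C]` with `C = [[A, 1], [1ᵀ, w]]` -/

/-- The column, indexed by `x`, of the matrix `[I | C]` whose rows are indexed by
`(X \ {e}) ∪ {f}`, where `C` is the block matrix `[[A, 1], [1ᵀ, w]]` with row block `X \ {e}`,
column block `(E \ X) \ {f}`, last column `e`, last row `f`, and corner entry `w`. -/
noncomputable def colVec (X : Set α) (e f : α) (A : α → α → GF4) (w : GF4) :
    α → ((X \ {e} ∪ {f} : Set α) → GF4) := fun x r =>
  if x ∈ X \ {e} ∪ ({f} : Set α) then (if (r : α) = x then 1 else 0)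
  else if (r : α) = f then (if x = e then w else 1)
  else if x = e then 1 else A (r : α) x

/-- `M = M[I | C]` where `C` is the block matrix `[[A, 1], [1ᵀ, w]]` relative to the
basis `(X \ {e}) ∪ {f}`. -/
def RepBy (M : Matroid α) (X : Set α) (e f : α) (A : α → α → GF4) (w : GF4) : Prop :=
  ∀ I ⊆ M.E, (M.Indep I ↔
    LinearIndependent GF4 (fun x : I => colVec X e f A w (x : α)))

/-- The matrix `B`, with rows restricted to `R` and columns restricted to `K`, has an
`m × n` submatrix (up to permuting rows and columns) equal to the pattern `P`. -/
def HasPattern {m n : ℕ} (B : α → α → GF4) (R K : Set α) (P : Fin m → Fin n → GF4) : Prop :=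
  ∃ (r : Fin m → α) (c : Fin n → α), Function.Injective r ∧ Function.Injective c ∧
    (∀ i, r i ∈ R) ∧ (∀ j, c j ∈ K) ∧ ∀ i j, B (r i) (c j) = P i j

/-- One non-zero element of GF(4). -/
def NZ1 (x : GF4) : Prop := x ≠ 0

/-- Two distinct non-zero elements of GF(4). -/
def NZ2 (x y : GF4) : Prop := x ≠ 0 ∧ y ≠ 0 ∧ x ≠ y

/-- Three distinct non-zero elements of GF(4). -/
def NZ3 (x y z : GF4) : Prop :=
  x ≠ 0 ∧ y ≠ 0 ∧ z ≠ 0 ∧ x ≠ y ∧ x ≠ z ∧ y ≠ z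

/-- `B` (with rows from `R` and columns from `K`) contains one of the fifteen forbidden
submatrices, up to permuting rows and columns, where `x, y, z` denote distinct non-zero
elements of GF(4). -/
def HasForbidden (B : α → α → GF4) (R K : Set α) : Prop :=
  (∃ x y z, NZ3 x y z ∧ HasPattern B R K ![![x, y, z]]) ∨
  (∃ x y, NZ2 x y ∧ HasPattern B R K ![![x, y], ![0, x]]) ∨
  (∃ x y, NZ2 x y ∧ HasPattern B R K ![![x, y], ![y, x]]) ∨
  (∃ x y z, NZ3 x y z ∧ HasPattern B R K ![![x, y], ![z, x]]) ∨
  (∃ x y z, NZ3 x y z ∧ HasPattern B R K ![![x, x], ![y, z]]) ∨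
  (∃ x, NZ1 x ∧ HasPattern B R K ![![x, x, 0], ![x, 0, x]]) ∨
  (∃ x y, NZ2 x y ∧ HasPattern B R K ![![x, x, 0], ![x, 0, y]]) ∨
  (∃ x y, NZ2 x y ∧ HasPattern B R K ![![x, x, 0], ![y, 0, y]]) ∨
  (∃ x y, NZ2 x y ∧ HasPattern B R K ![![x, y, 0], ![x, 0, y]]) ∨
  (∃ x y z, NZ3 x y z ∧ HasPattern B R K ![![x, 0, 0], ![0, y, z]]) ∨
  (∃ x, NZ1 x ∧ HasPattern B R K ![![x, 0, 0], ![0, x, 0], ![0, 0, x]]) ∨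
  (∃ x y, NZ2 x y ∧ HasPattern B R K ![![x, 0, 0], ![0, x, 0], ![0, 0, y]]) ∨
  (∃ x y z, NZ3 x y z ∧ HasPattern B R K ![![x, 0, 0], ![0, y, 0], ![0, 0, z]]) ∨
  (∃ x y, NZ2 x y ∧ HasPattern B R K ![![x, y, x], ![y, y, 0], ![x, 0, 0]]) ∨
  (∃ x y z, NZ3 x y z ∧ HasPattern B R K ![![x, y, x], ![y, y, 0], ![x, 0, z]])

/-! ### The matroids `P₈⁻`, `F₇⁼` and its dual -/

/-- The columns of the GF(3)-matrix `[I₄ | A]` representing `P₈`, where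
`A = [[0,1,1,-1],[1,0,1,1],[1,1,0,1],[-1,1,1,0]]`. -/
def P8cols : Fin 8 → Fin 4 → ZMod 3 :=
  ![![1, 0, 0, 0], ![0, 1, 0, 0], ![0, 0, 1, 0], ![0, 0, 0, 1],
    ![0, 1, 1, -1], ![1, 0, 1, 1], ![1, 1, 0, 1], ![-1, 1, 1, 0]]

/-- `M` is isomorphic to `P₈`. -/
def IsP8 (M : Matroid α) : Prop :=
  ∃ g : α → Fin 8, Set.BijOn g M.E Set.univ ∧
    ∀ I ⊆ M.E, (M.Indep I ↔ LinearIndependent (ZMod 3) (fun x : I => P8cols (g (x : α))))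

/-- `M` is isomorphic to `P₈⁻`: it is obtained from a copy of `P₈` by relaxing one of its
pair of disjoint circuit-hyperplanes. -/
def IsP8Minus (M : Matroid α) : Prop :=
  ∃ (N : Matroid α) (X Y : Set α), IsP8 N ∧ CircuitHyperplane N Y ∧ Disjoint X Y ∧
    IsRelaxation N M X

/-- The columns of the rational matrix representing the non-Fano matroid `F₇⁻`: the seven
non-zero `{0,1}`-vectors of length 3. -/
def F7cols : Fin 7 → Fin 3 → ℚ :=
  ![![1, 0, 0], ![0, 1, 0], ![0, 0, 1], ![1, 1, 0], ![1, 0, 1], ![0, 1, 1], ![1, 1, 1]]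

/-- `M` is isomorphic to the non-Fano matroid `F₇⁻`. -/
def IsF7Minus (M : Matroid α) : Prop :=
  ∃ g : α → Fin 7, Set.BijOn g M.E Set.univ ∧
    ∀ I ⊆ M.E, (M.Indep I ↔ LinearIndependent ℚ (fun x : I => F7cols (g (x : α))))

/-- `M` is isomorphic to `F₇⁼`: it is obtained from a copy of `F₇⁻` by relaxing a
circuit-hyperplane. -/
def IsF7Eq (M : Matroid α) : Prop :=
  ∃ (N : Matroid α) (X : Set α), IsF7Minus N ∧ IsRelaxation N M X

end Relax

namespace Relax

/-- The rank of a set, as a natural number. -/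
noncomputable def nrk {α : Type*} (M : Matroid α) (X : Set α) : ℕ := (M.eRk X).toNat

section Rank

variable {α : Type*} {M : Matroid α} [M.Finite] {X Y U I C T : Set α} {e : α} {k : ℕ}

lemma cast_nrk (M : Matroid α) [M.Finite] (X : Set α) : (nrk M X : ℕ∞) = M.eRk X :=
  ENat.natCast_toNat (eRk_ne_top_iff.2 (M.isRkFinite_set X))

lemma nrk_mono (h : X ⊆ Y) : nrk M X ≤ nrk M Y := by
  have := M.eRk_mono h
  rw [← cast_nrk, ← cast_nrk] at this
  exact_mod_cast this

lemma nrk_submod (hU : U ⊆ X ∪ Y) (hX : I ⊆ X) (hY : I ⊆ Y) :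
    nrk M U + nrk M I ≤ nrk M X + nrk M Y := by
  have h := M.eRk_inter_add_eRk_union_le X Y
  simp only [← cast_nrk] at h
  norm_cast at h
  have h1 := nrk_mono (M := M) hU
  have h2 := nrk_mono (M := M) (subset_inter hX hY)
  omega

@[simp]
lemma nrk_empty (M : Matroid α) [M.Finite] : nrk M ∅ = 0 := by
  simp [nrk]

lemma nrk_singleton_le (M : Matroid α) [M.Finite] (e : α) : nrk M {e} ≤ 1 := by
  have := M.eRk_singleton_le e
  rw [← cast_nrk] at this
  exact_mod_cast this

lemma nrk_le_add_singleton (hU : U ⊆ insert e X) : nrk M U ≤ nrk M X + 1 := by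
  have h := nrk_submod (M := M) (U := U) (X := X) (Y := {e}) (I := ∅)
    (by rwa [union_singleton]) (empty_subset _) (empty_subset _)
  have := nrk_singleton_le M e
  simp at h
  omega

lemma indep_iff_nrk (hI : I.Finite) : M.Indep I ↔ nrk M I = I.ncard := by
  rw [indep_iff_eRk_eq_encard_of_finite hI, ← cast_nrk, ← hI.cast_ncard_eq]
  norm_cast

lemma nrk_le_ncard (hI : I.Finite) : nrk M I ≤ I.ncard := by
  have := M.eRk_le_encard I
  rw [← cast_nrk, ← hI.cast_ncard_eq] at this
  exact_mod_cast this

lemma nrk_dual (hX : X ⊆ M.E) :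
    nrk M✶ X + nrk M M.E = nrk M (M.E \ X) + X.ncard := by
  have h := M.eRk_dual_add_eRank X hX
  rw [eRank_def, ← (M.ground_finite.subset hX).cast_ncard_eq] at h
  simp only [← cast_nrk] at h
  exact_mod_cast h

lemma contract_indep_iff_nrk (hI : I.Finite) (hd : Disjoint C I) :
    (M ／ C).Indep I ↔ nrk M (C ∪ I) = nrk M C + I.ncard := by
  obtain ⟨J, hJ⟩ := M.exists_isBasis' C
  have hJf : J.Finite := M.set_finite J hJ.indep.subset_ground
  have hu : nrk M (J ∪ I) = nrk M (C ∪ I) := by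
    unfold nrk; rw [hJ.eRk_eq_eRk_union]
  have hc : nrk M C = J.ncard := by
    unfold nrk; rw [hJ.eRk_eq_encard]; rfl
  rw [hJ.contract_indep_iff, union_comm, indep_iff_nrk (hJf.union hI), hu, hc,
    ncard_union_eq (hd.mono_left hJ.subset) hJf hI]
  exact and_iff_left hd

/-- `M ／ C` restricted to the `5`-element set `T` is uniform of rank `k`, phrased via ranks. -/
def UnifAt (M : Matroid α) (C T : Set α) (k : ℕ) : Prop :=
  C ⊆ M.E ∧ T ⊆ M.E ∧ Disjoint C T ∧ T.ncard = 5 ∧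
    ∀ I ⊆ T, nrk M (C ∪ I) = nrk M C + min I.ncard k

lemma UnifAt.isUniform (h : UnifAt M C T k) :
    IsUniform (M ／ C ＼ (M.E \ (C ∪ T))) k 5 := by
  obtain ⟨hC, hT, hd, h5, hr⟩ := h
  have hE : (M ／ C ＼ (M.E \ (C ∪ T))).E = T := by
    have := disjoint_left.1 hd
    ext x
    have := @hT x
    simp only [delete_ground, contract_ground, mem_sdiff, mem_union]
    grind
  have hTf : T.Finite := M.set_finite T hT
  rw [IsUniform, hE]
  refine ⟨hTf, h5, fun I hI ↦ ?_⟩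
  have hdI : Disjoint I (M.E \ (C ∪ T)) :=
    disjoint_left.2 fun x hx hx' ↦ hx'.2 (Or.inr (hI hx))
  rw [delete_indep_iff, and_iff_left hdI,
    contract_indep_iff_nrk (hTf.subset hI) (hd.mono_right hI), hr I hI]
  omega

lemma HasUnifMinor.exists_unifAt (h : HasUnifMinor M k 5) :
    ∃ C T, UnifAt M C T k := by
  obtain ⟨_, ⟨C, D, hC, hD, hCD, rfl⟩, hU⟩ := h
  change IsUniform (M ／ C ＼ D) k 5 at hU
  obtain ⟨hf, h5, hi⟩ := hU
  set T := (M ／ C ＼ D).E with hT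
  have hTE : T = (M.E \ C) \ D := rfl
  have hdT : Disjoint C T := by
    rw [disjoint_left]; intro x hx hx'; rw [hTE] at hx'; exact hx'.1.2 hx
  have key : ∀ I ⊆ T, (nrk M (C ∪ I) = nrk M C + I.ncard ↔ I.ncard ≤ k) := by
    intro I hI
    have hdI : Disjoint I D :=
      disjoint_left.2 fun x hx hx' ↦ (hI hx).2 hx'
    rw [← hi I hI, delete_indep_iff, and_iff_left hdI,
      contract_indep_iff_nrk (hf.subset hI) (hdT.mono_right hI)]
  refine ⟨C, T, hC, (by rw [hTE]; exact fun x hx ↦ hx.1.1), hdT, h5, fun I hI ↦ ?_⟩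
  rcases le_or_gt I.ncard k with hle | hlt
  · rw [(key I hI).2 hle, min_eq_left hle]
  obtain ⟨J, hJI, hJ⟩ := exists_subset_card_eq hlt.le
  have hJT := hJI.trans hI
  have hJr := (key J hJT).2 hJ.le
  have hJf := hf.subset hJT
  have : M.eRk (C ∪ J) = M.eRk (C ∪ I) := by
    refine eRk_eq_of_eRk_insert_le_forall (union_subset_union_right _ hJI) fun x hx ↦ ?_
    have hxJ : x ∉ J := fun h ↦ hx.2 (Or.inr h)
    have hxI : x ∈ I := hx.1.resolve_left fun h ↦ hx.2 (Or.inl h)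
    have h1 := (key (insert x J) (insert_subset (hI hxI) hJT)).not
    rw [ncard_insert_of_notMem hxJ hJf, union_insert] at h1
    have h2 := nrk_le_add_singleton (M := M) (subset_refl (insert x (C ∪ J)))
    rw [← cast_nrk, ← cast_nrk]
    norm_cast
    have h3 := h1.2 (by omega)
    omega
  have h' : nrk M (C ∪ J) = nrk M (C ∪ I) := by unfold nrk; rw [this]
  rw [← h', hJr, min_eq_right hlt.le, hJ]

lemma UnifAt.hasUnifMinor_delete (h : UnifAt M C T k) (he : e ∈ M.E) (heC : e ∉ C)
    (heT : e ∉ T) : HasUnifMinor (delete M {e}) k 5 := by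
  refine ⟨_, ⟨C, (M.E \ (C ∪ T)) \ {e}, ?_, ?_, ?_, ?_⟩, h.isUniform⟩
  · exact subset_sdiff_singleton h.1 heC
  · exact sdiff_subset_sdiff_left sdiff_subset
  · exact disjoint_left.2 fun x hx hx' ↦ hx'.1.2 (Or.inl hx)
  · change _ = M ＼ {e} ／ C ＼ ((M.E \ (C ∪ T)) \ {e})
    rw [← contract_delete_comm M (disjoint_singleton_right.2 heC), delete_delete,
      singleton_union, insert_sdiff_singleton,
      insert_eq_of_mem (a := e) (s := M.E \ (C ∪ T)) ⟨he, by simp [heC, heT]⟩]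

lemma UnifAt.hasUnifMinor_contract (h : UnifAt M C T k) (heC : e ∈ C) :
    HasUnifMinor (contract M {e}) k 5 := by
  refine ⟨_, ⟨C \ {e}, M.E \ (C ∪ T), ?_, ?_, ?_, ?_⟩, h.isUniform⟩
  · exact sdiff_subset_sdiff_left h.1
  · exact fun x hx ↦ ⟨hx.1, fun h' ↦ hx.2 (Or.inl (h' ▸ heC))⟩
  · exact disjoint_left.2 fun x hx hx' ↦ hx'.2 (Or.inl hx.1)
  · change _ = M ／ {e} ／ (C \ {e}) ＼ (M.E \ (C ∪ T))
    rw [contract_contract, singleton_union, insert_sdiff_singleton, insert_eq_of_mem heC]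

/-- `M ／ C` restricted to `T` is `U_{2,5}` or `U_{3,5}`. -/
def GoodAt (M : Matroid α) (C T : Set α) : Prop := UnifAt M C T 2 ∨ UnifAt M C T 3

lemma FragileU25U35.exists_goodAt (h : FragileU25U35 M) : ∃ C T, GoodAt M C T := by
  rcases h.1 with h | h
  · obtain ⟨C, T, h⟩ := h.exists_unifAt
    exact ⟨C, T, Or.inl h⟩
  · obtain ⟨C, T, h⟩ := h.exists_unifAt
    exact ⟨C, T, Or.inr h⟩

lemma FragileU25U35.not_goodAt (h : FragileU25U35 M) {C' T' : Set α} (he : e ∈ M.E)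
    (h1 : GoodAt M C T) (heC : e ∉ C) (heT : e ∉ T) (h2 : GoodAt M C' T') (heC' : e ∈ C') :
    False :=
  h.2 e he ⟨h1.imp (·.hasUnifMinor_delete he heC heT) (·.hasUnifMinor_delete he heC heT),
    h2.imp (·.hasUnifMinor_contract heC') (·.hasUnifMinor_contract heC')⟩

lemma parallelClass_of_nrk {B : Set α} (hB : B ⊆ M.E) (hne : B.Nonempty)
    (h1 : ∀ x ∈ B, nrk M {x} = 1) (h2 : ∀ x ∈ B, ∀ y ∈ B, x ≠ y → nrk M {x, y} ≤ 1)
    (h3 : ∀ x ∈ B, ∀ s ∈ M.E \ B, 2 ≤ nrk M {s, x}) : ParallelClass M B := by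
  have hind : ∀ x ∈ B, M.Indep {x} := fun x hx ↦ by
    rw [indep_iff_nrk (finite_singleton x), h1 x hx, ncard_singleton]
  refine ⟨hB, fun x hx hl ↦ hl.2 (hind x hx), fun x hx y hy hxy ↦ ⟨hxy, ⟨⟨?_, ?_⟩, ?_⟩⟩, ?_⟩
  · rw [indep_iff_nrk (toFinite _), ncard_pair hxy]
    have := h2 x hx y hy hxy
    omega
  · exact insert_subset (hB hx) (singleton_subset_iff.2 (hB hy))
  · intro D hD
    obtain ⟨z, hz, hzD⟩ := exists_of_ssubset hD
    rcases hz with rfl | rfl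
    · exact (hind y hy).subset fun w hw ↦ (hD.1 hw).resolve_left fun h ↦ hzD (h ▸ hw)
    · exact (hind x hx).subset fun w hw ↦ (hD.1 hw).resolve_right fun h ↦ hzD (h ▸ hw)
  · refine fun B' hBB' hB' _ hp ↦ (subset_antisymm hBB' fun s hs ↦ ?_).symm
    by_contra hsB
    obtain ⟨x, hx⟩ := hne
    have hsx : s ≠ x := fun h ↦ hsB (h ▸ hx)
    have hd := (hp s hs x (hBB' hx) hsx).2.1.1
    rw [indep_iff_nrk (toFinite _), ncard_pair hsx] at hd
    have := nrk_le_ncard (M := M) (toFinite {s, x})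
    rw [ncard_pair hsx] at this
    have := h3 x hx s ⟨hB' hs, hsB⟩
    omega


lemma UnifAt.of_nrk {C' : Set α} (h : UnifAt M C T k) (hC' : C' ⊆ M.E) (hd : Disjoint C' T)
    (a b : ℕ) (hr : ∀ I ⊆ T, nrk M (C' ∪ I) + a = nrk M (C ∪ I) + b) : UnifAt M C' T k := by
  refine ⟨hC', h.2.1, hd, h.2.2.2.1, fun I hI ↦ ?_⟩
  have h1 := hr I hI
  have h2 := hr ∅ (empty_subset _)
  have h3 := h.2.2.2.2 I hI
  simp only [union_empty] at h2
  omega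

lemma GoodAt.of_nrk {C' : Set α} (h : GoodAt M C T) (hC' : C' ⊆ M.E) (hd : Disjoint C' T)
    (a b : ℕ) (hr : ∀ I ⊆ T, nrk M (C' ∪ I) + a = nrk M (C ∪ I) + b) : GoodAt M C' T :=
  h.imp (·.of_nrk hC' hd a b hr) (·.of_nrk hC' hd a b hr)

lemma GoodAt.exists_unifAt (h : GoodAt M C T) : ∃ k, (k = 2 ∨ k = 3) ∧ UnifAt M C T k :=
  h.elim (fun h ↦ ⟨2, Or.inl rfl, h⟩) (fun h ↦ ⟨3, Or.inr rfl, h⟩)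

/-- A rank-two set `S` without loops or parallel pairs whose complement `B` is not spanning. -/
structure LineSep (M : Matroid α) (S B : Set α) : Prop where
  union_eq : S ∪ B = M.E
  disj : ∀ x ∈ S, x ∉ B
  nrk_le : nrk M S ≤ 2
  pair : ∀ x ∈ S, ∀ y ∈ S, x ≠ y → 2 ≤ nrk M {x, y}
  sep : nrk M B + 1 ≤ nrk M M.E

lemma nrk_add_one_le_of_subset (h : nrk M Y + 1 ≤ nrk M (insert e Y)) (hX : X ⊆ Y) :
    nrk M X + 1 ≤ nrk M (insert e X) := by
  have := nrk_submod (M := M) (U := insert e Y) (X := insert e X) (Y := Y) (I := X)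
    (by intro x; simp; tauto) (subset_insert _ _) hX
  omega

/-- The connectivity between two sides of a partition does not increase in a minor. -/
lemma GoodAt.ncard_inter (h : GoodAt M C T) {P Q : Set α} (hPQ : P ∪ Q = M.E)
    (hd : ∀ x ∈ P, x ∉ Q) (hs : nrk M P + nrk M Q ≤ nrk M M.E + 1) :
    (T ∩ P).ncard ≤ 1 ∨ 4 ≤ (T ∩ P).ncard := by
  obtain ⟨k, hk, hC, hT, hCT, h5, hr⟩ := h.exists_unifAt
  have hTf := M.set_finite T hT
  have hE : ∀ x, x ∈ M.E ↔ x ∈ P ∨ x ∈ Q := fun x ↦ by rw [← hPQ]; rfl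
  have e1 := nrk_submod (M := M) (U := P ∪ C) (X := P) (Y := C) (I := C ∩ P)
    subset_rfl inter_subset_right inter_subset_left
  have e2 := nrk_submod (M := M) (U := Q ∪ C) (X := Q) (Y := C) (I := C ∩ Q)
    subset_rfl inter_subset_right inter_subset_left
  have e3 := nrk_submod (M := M) (U := C) (X := C ∩ P) (Y := C ∩ Q) (I := ∅)
    (fun x hx ↦ by have := (hE x).1 (hC hx); simp; tauto) (empty_subset _) (empty_subset _)
  have e4 := nrk_submod (M := M) (U := P ∪ C ∪ (T ∩ Q)) (X := P ∪ C) (Y := C ∪ T)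
    (I := C ∪ (T ∩ P)) (by intro x; simp; tauto) (by intro x; simp; tauto)
    (by intro x; simp; tauto)
  have e5 := nrk_submod (M := M) (U := M.E) (X := P ∪ C ∪ (T ∩ Q)) (Y := Q ∪ C)
    (I := C ∪ (T ∩ Q)) (by intro x; simp [hE]; tauto) (by intro x; simp; tauto)
    (by intro x; simp; tauto)
  have h1 := hr (T ∩ P) inter_subset_left
  have h2 := hr (T ∩ Q) inter_subset_left
  have h3 := hr T subset_rfl
  have hTQ : T \ P = T ∩ Q := by
    ext x
    have := hd x
    have := fun hx ↦ (hE x).1 (@hT x hx)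
    simp
    tauto
  have h4 := ncard_inter_add_ncard_sdiff_eq_ncard T P hTf
  rw [hTQ] at h4
  simp only [nrk_empty] at e3
  rcases hk with rfl | rfl <;> omega

namespace LineSep

variable {S B : Set α} {c d q s t : α}

lemma mem_ground_iff (hL : LineSep M S B) {x : α} : x ∈ M.E ↔ x ∈ S ∨ x ∈ B := by
  rw [← hL.union_eq]; rfl

lemma subset_left (hL : LineSep M S B) : S ⊆ M.E := fun _ h ↦ hL.mem_ground_iff.2 (Or.inl h)

lemma subset_right (hL : LineSep M S B) : B ⊆ M.E := fun _ h ↦ hL.mem_ground_iff.2 (Or.inr h)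

lemma nrk_union_le (hL : LineSep M S B) (hc : c ∈ S) (hd : d ∈ S) (hcd : c ≠ d)
    (hcY : c ∈ Y) (hdY : d ∈ Y) (hU : U ⊆ Y ∪ S) : nrk M U ≤ nrk M Y := by
  have := nrk_submod (M := M) (X := Y) (Y := S) (I := {c, d}) hU
    (by intro x; simp; rintro (rfl | rfl) <;> assumption)
    (by intro x; simp; rintro (rfl | rfl) <;> assumption)
  have := hL.pair c hc d hd hcd
  have := hL.nrk_le
  omega

lemma ground_le (hL : LineSep M S B) (hc : c ∈ S) (hd : d ∈ S) (hcd : c ≠ d) :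
    nrk M M.E ≤ nrk M (insert c (insert d B)) :=
  hL.nrk_union_le hc hd hcd (by simp) (by simp) fun x hx ↦ by
    have := hL.mem_ground_iff.1 hx
    simp
    tauto

lemma off_or (hL : LineSep M S B) (hc : c ∈ S) (hd : d ∈ S) (hcd : c ≠ d) :
    nrk M B + 1 ≤ nrk M (insert c B) ∨ nrk M B + 1 ≤ nrk M (insert d B) := by
  have h1 := hL.ground_le hc hd hcd
  have h2 := nrk_submod (M := M) (U := insert c (insert d B)) (X := insert c B)
    (Y := insert d B) (I := B) (by intro x; simp; tauto) (by simp) (by simp)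
  have := hL.sep
  omega

lemma nrk_pos (hL : LineSep M S B) (hc : c ∈ S) (hd : d ∈ S) (hcd : c ≠ d) :
    nrk M {c} = 1 := by
  have h1 := hL.pair c hc d hd hcd
  have h2 := nrk_le_add_singleton (M := M) (U := {c, d}) (X := {c}) (e := d)
    (by intro x; simp; tauto)
  have := nrk_singleton_le M c
  omega

lemma exists_off (hL : LineSep M S B) (hS : 2 ≤ (S \ U).ncard) :
    ∃ q ∈ S, q ∉ U ∧ nrk M B + 1 ≤ nrk M (insert q B) := by
  obtain ⟨c, hc, d, hd, hcd⟩ :=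
    (one_lt_ncard (M.set_finite (S \ U) (sdiff_subset.trans hL.subset_left))).1 hS
  rcases hL.off_or hc.1 hd.1 hcd with h | h
  exacts [⟨c, hc.1, hc.2, h⟩, ⟨d, hd.1, hd.2, h⟩]

lemma nrk_insert_off (hq : nrk M B + 1 ≤ nrk M (insert q B)) (hX : X ⊆ B) :
    nrk M (insert q X) = nrk M X + 1 :=
  le_antisymm (nrk_le_add_singleton subset_rfl) (nrk_add_one_le_of_subset hq hX)

lemma not_goodAt_subset_right (hL : LineSep M S B) (hM : FragileU25U35 M) (hS : 3 ≤ S.ncard)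
    (h : GoodAt M C T) (hC : C ⊆ B) (hT : T ⊆ B) : False := by
  obtain ⟨q, hqS, -, hq⟩ := hL.exists_off (U := ∅) (by rw [sdiff_empty]; omega)
  have hqB := hL.disj q hqS
  obtain ⟨-, -, -, -, hd, -⟩ := h.exists_unifAt
  refine hM.not_goodAt (hL.subset_left hqS) h (fun h ↦ hqB (hC h)) (fun h ↦ hqB (hT h))
    (h.of_nrk (C' := insert q C) (insert_subset (hL.subset_left hqS) (hC.trans hL.subset_right))
      (disjoint_insert_left.2 ⟨fun h ↦ hqB (hT h), hd⟩) 0 1 fun I hI ↦ ?_) (mem_insert q C)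
  rw [insert_union, add_zero, nrk_insert_off hq (union_subset hC (hI.trans hT))]

lemma not_goodAt_union_left (hL : LineSep M S B) (hM : FragileU25U35 M) (hS : 3 ≤ S.ncard)
    (hC : C ⊆ B) (h : GoodAt M (C ∪ S) T) : False := by
  obtain ⟨x, y, z, hx, hy, hz, hxy, hxz, hyz⟩ :=
    (two_lt_ncard_iff (M.set_finite S hL.subset_left)).1 hS
  obtain ⟨-, -, -, -, hd, -⟩ := h.exists_unifAt
  have hsub : C ∪ (S \ {x}) ⊆ C ∪ S := union_subset_union_right _ sdiff_subset
  refine hM.not_goodAt (hL.subset_left hx)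
    (h.of_nrk (C' := C ∪ (S \ {x}))
      (union_subset (hC.trans hL.subset_right) (sdiff_subset.trans hL.subset_left))
      (hd.mono_left hsub) 0 0 fun I _ ↦ ?_) ?_
      (disjoint_left.1 hd (Or.inr hx)) h (Or.inr hx)
  · refine congrArg (· + 0) (le_antisymm (nrk_mono (union_subset_union_left _ hsub)) ?_)
    refine hL.nrk_union_le hy hz hyz ?_ ?_ ?_
    · exact Or.inl (Or.inr ⟨hy, hxy.symm⟩)
    · exact Or.inl (Or.inr ⟨hz, hxz.symm⟩)
    · intro w; simp; tauto
  · rintro (h | h)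
    exacts [hL.disj x hx (hC h), h.2 rfl]

lemma not_goodAt_of_disjoint (hL : LineSep M S B) (hM : FragileU25U35 M) (hS : 3 ≤ S.ncard)
    (h : GoodAt M C T) (hTS : ∀ x ∈ T, x ∉ S) : False := by
  obtain ⟨-, -, hC, hT, hd, -⟩ := h.exists_unifAt
  have hTB : T ⊆ B := fun x hx ↦ (hL.mem_ground_iff.1 (hT hx)).resolve_left (hTS x hx)
  have hC' : ∀ x ∈ C, x ∈ S ∨ x ∈ B := fun x hx ↦ hL.mem_ground_iff.1 (hC hx)
  have hCB : C ∩ B ⊆ B := inter_subset_right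
  have hdB : Disjoint (C ∩ B) T := hd.mono_left inter_subset_left
  have hdS : Disjoint (C ∩ B ∪ S) T :=
    disjoint_union_left.2 ⟨hdB, disjoint_left.2 fun x hx hx' ↦ hTS x hx' hx⟩
  have hCBE : C ∩ B ⊆ M.E := hCB.trans hL.subset_right
  have hCSE : C ∩ B ∪ S ⊆ M.E := union_subset hCBE hL.subset_left
  rcases (C ∩ S).eq_empty_or_nonempty with h0 | ⟨c, hcC, hcS⟩
  · have : C ⊆ B := fun x hx ↦ (hC' x hx).resolve_left fun hxS ↦
      (h0 ▸ (⟨hx, hxS⟩ : x ∈ C ∩ S) : x ∈ (∅ : Set α))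
    exact hL.not_goodAt_subset_right hM hS h this hTB
  by_cases h2 : ∃ d ∈ C ∩ S, c ≠ d
  · obtain ⟨d, ⟨hdC, hdS'⟩, hcd⟩ := h2
    refine hL.not_goodAt_union_left hM hS hCB (h.of_nrk hCSE hdS 0 0 fun I _ ↦ ?_)
    refine congrArg (· + 0) (le_antisymm ?_ (nrk_mono ?_))
    · exact hL.nrk_union_le hcS hdS' hcd (Or.inl hcC) (Or.inl hdC) (by intro x; simp; tauto)
    · intro x; have := hC' x; simp; tauto
  · push Not at h2
    have hCeq : C = insert c (C ∩ B) := by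
      ext x
      simp only [mem_insert_iff, mem_inter_iff]
      constructor
      · intro hx
        rcases hC' x hx with hxS | hxB
        exacts [Or.inl (h2 x ⟨hx, hxS⟩).symm, Or.inr ⟨hx, hxB⟩]
      · rintro (rfl | hx)
        exacts [hcC, hx.1]
    by_cases hc : nrk M B + 1 ≤ nrk M (insert c B)
    · refine hL.not_goodAt_subset_right hM hS (h.of_nrk hCBE hdB 1 0 fun I hI ↦ ?_) hCB hTB
      conv_rhs => rw [hCeq, insert_union]
      rw [nrk_insert_off hc (union_subset hCB (hI.trans hTB)), add_zero]
    · refine hL.not_goodAt_union_left hM hS hCB (h.of_nrk hCSE hdS 0 1 fun I hI ↦ ?_)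
      have hX : C ∩ B ∪ I ⊆ B := union_subset hCB (hI.trans hTB)
      obtain ⟨d, hdS', hdc⟩ := exists_ne_of_one_lt_ncard (show 1 < S.ncard by omega) c
      have h3 := hL.nrk_pos hcS hdS' hdc.symm
      have h4 := hL.nrk_le
      have h5 := hL.sep
      have h6 := nrk_submod (M := M) (U := C ∩ B ∪ S ∪ I) (X := C ∪ I) (Y := S) (I := {c})
        (by intro x; simp; tauto) (by simp [hcC]) (by simpa)
      have h7 := nrk_submod (M := M) (U := M.E) (X := C ∩ B ∪ S ∪ I) (Y := insert c B)
        (I := C ∪ I) (fun x hx ↦ by have := hL.mem_ground_iff.1 hx; simp; tauto)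
        (fun x ↦ by have := hC' x; simp; tauto)
        (by rw [hCeq, insert_union]; exact insert_subset_insert hX)
      omega

lemma not_goodAt_of_inter_eq_singleton (hL : LineSep M S B) (hM : FragileU25U35 M)
    (hS : 3 ≤ S.ncard) (h : GoodAt M C T) (ht : t ∈ T) (htS : t ∈ S)
    (hTS : ∀ x ∈ T, x ∈ S → x = t) : False := by
  obtain ⟨k, hk, hC, hT, hd, h5, hr⟩ := h.exists_unifAt
  have hTf := M.set_finite T hT
  have hC' : ∀ x ∈ C, x ∈ S ∨ x ∈ B := fun x hx ↦ hL.mem_ground_iff.1 (hC hx)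
  have hT' : ∀ x ∈ T, x = t ∨ x ∈ B := fun x hx ↦
    (hL.mem_ground_iff.1 (hT hx)).imp_left (hTS x hx)
  have htC : t ∉ C := disjoint_right.1 hd ht
  have hdB : Disjoint (C ∩ B) T := hd.mono_left inter_subset_left
  have hCBE : C ∩ B ⊆ M.E := inter_subset_right.trans hL.subset_right
  have hcol : nrk M (C ∪ T) = nrk M (C ∪ (T \ {t})) := by
    rw [hr T subset_rfl, hr _ sdiff_subset, ncard_sdiff_singleton_of_mem ht]
    rcases hk with rfl | rfl <;> omega
  have hnc : nrk M (C ∪ {t}) = nrk M C + 1 := by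
    rw [hr _ (singleton_subset_iff.2 ht), ncard_singleton]
    rcases hk with rfl | rfl <;> omega
  -- `t` is not a coloop of the minor
  have key : ∀ Y, C ∪ (T \ {t}) ⊆ Y → ¬ nrk M Y + 1 ≤ nrk M (insert t Y) := fun Y hY hlt ↦ by
    have h1 := nrk_add_one_le_of_subset hlt hY
    rw [← union_insert, insert_sdiff_singleton, insert_eq_of_mem ht] at h1
    omega
  rcases (C ∩ S).eq_empty_or_nonempty with h0 | ⟨c, hcC, hcS⟩
  · have hCB : C ⊆ B := fun x hx ↦ (hC' x hx).resolve_left fun hxS ↦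
      (h0 ▸ (⟨hx, hxS⟩ : x ∈ C ∩ S) : x ∈ (∅ : Set α))
    have htB := key B (union_subset hCB fun x hx ↦ (hT' x hx.1).resolve_left hx.2)
    obtain ⟨q, hqS, hqt⟩ := exists_ne_of_one_lt_ncard (show 1 < S.ncard by omega) t
    have hqB := hL.disj q hqS
    have hqT : q ∉ T := fun h ↦ hqt (hTS q h hqS)
    have hq : nrk M (insert t B) + 1 ≤ nrk M (insert q (insert t B)) := by
      have := hL.ground_le hqS htS hqt
      have := hL.sep
      omega
    refine hM.not_goodAt (hL.subset_left hqS) h (fun h ↦ hqB (hCB h)) hqT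
      (h.of_nrk (C' := insert q C) (insert_subset (hL.subset_left hqS) hC)
        (disjoint_insert_left.2 ⟨hqT, hd⟩) 0 1 fun I hI ↦ ?_) (mem_insert q C)
    rw [insert_union, add_zero, nrk_insert_off hq]
    exact union_subset (hCB.trans (subset_insert _ _)) fun x hx ↦ hT' x (hI hx)
  by_cases h2 : ∃ d ∈ C ∩ S, c ≠ d
  · obtain ⟨d, ⟨hdC, hdS⟩, hcd⟩ := h2
    have := hL.nrk_union_le hcS hdS hcd hcC hdC (U := C ∪ {t})
      (union_subset_union_right _ (by simpa))
    omega
  push Not at h2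
  have hCeq : C = insert c (C ∩ B) := by
    ext x
    simp only [mem_insert_iff, mem_inter_iff]
    constructor
    · intro hx
      rcases hC' x hx with hxS | hxB
      exacts [Or.inl (h2 x ⟨hx, hxS⟩).symm, Or.inr ⟨hx, hxB⟩]
    · rintro (rfl | hx)
      exacts [hcC, hx.1]
  have hct : c ≠ t := fun h ↦ htC (h ▸ hcC)
  have hCsub : C ∪ (T \ {t}) ⊆ insert c B := by
    rw [hCeq]
    refine union_subset (insert_subset_insert inter_subset_right) fun x hx ↦
      Or.inr ((hT' x hx.1).resolve_left hx.2)
  have hcB := key _ hCsub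
  have hcoff : nrk M B + 1 ≤ nrk M (insert c B) := by
    have := hL.ground_le htS hcS hct.symm
    have := hL.sep
    omega
  obtain ⟨s, hsS, hsct⟩ : ∃ s ∈ S, s ∉ ({c, t} : Set α) :=
    exists_mem_notMem_of_ncard_lt_ncard (by rw [ncard_pair hct]; omega) (toFinite _)
  have hsc : s ≠ c := fun h ↦ hsct (by simp [h])
  have hst : s ≠ t := fun h ↦ hsct (by simp [h])
  have hsB := hL.disj s hsS
  have hsC : s ∉ C := fun h ↦ hsc (h2 s ⟨h, hsS⟩).symm
  have hsT : s ∉ T := fun h ↦ hst (hTS s h hsS)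
  have hswap : ∀ {a b Y}, a ∈ S → b ∈ S → a ≠ b → a ∈ Y → b ∈ Y → nrk M Y = nrk M (Y ∪ S) :=
    fun ha hb hab haY hbY ↦ le_antisymm (nrk_mono subset_union_left)
      (hL.nrk_union_le ha hb hab haY hbY subset_rfl)
  have hIB : ∀ I ⊆ T, t ∉ I → C ∩ B ∪ I ⊆ B := fun I hI htI ↦
    union_subset inter_subset_right fun x hx ↦
      (hT' x (hI hx)).resolve_left fun h ↦ htI (h ▸ hx)
  by_cases hs : nrk M B + 1 ≤ nrk M (insert s B)
  · refine hM.not_goodAt (hL.subset_left hsS) h hsC hsT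
      (h.of_nrk (C' := insert s (C ∩ B)) (insert_subset (hL.subset_left hsS) hCBE)
        (disjoint_insert_left.2 ⟨hsT, hdB⟩) 0 0 fun I hI ↦ ?_) (mem_insert _ _)
    rw [add_zero, add_zero]
    by_cases htI : t ∈ I
    · rw [hswap (Y := insert s (C ∩ B) ∪ I) hsS htS hst (Or.inl (mem_insert _ _)) (Or.inr htI),
        hswap (Y := C ∪ I) hcS htS hct (Or.inl hcC) (Or.inr htI)]
      congr 1
      ext x
      have := hC' x
      simp
      grind
    · conv_rhs => rw [hCeq]
      rw [insert_union, insert_union, nrk_insert_off hs (hIB I hI htI),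
        nrk_insert_off hcoff (hIB I hI htI)]
  · have hcs : nrk M (insert s B) + 1 ≤ nrk M (insert c (insert s B)) := by
      have := hL.ground_le hcS hsS hsc.symm
      have := hL.sep
      omega
    have hT'd : Disjoint (C ∩ B) (insert s (T \ {t})) :=
      disjoint_insert_right.2 ⟨fun h ↦ hsC h.1, hdB.mono_right sdiff_subset⟩
    have hu : UnifAt M (C ∩ B) (insert s (T \ {t})) k := by
      have hC0 : nrk M C = nrk M (C ∩ B) + 1 := by
        conv_lhs => rw [hCeq]
        exact nrk_insert_off hcoff inter_subset_right
      have hmain : ∀ I ⊆ T \ {t}, nrk M (C ∩ B ∪ I) + 1 = nrk M (C ∪ I) := fun I hI ↦ by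
        conv_rhs => rw [hCeq]
        rw [insert_union, nrk_insert_off hcoff]
        exact hIB I (hI.trans sdiff_subset) fun h ↦ (hI h).2 rfl
      refine ⟨hCBE, insert_subset (hL.subset_left hsS) (sdiff_subset.trans hT), hT'd, ?_, ?_⟩
      · rw [ncard_insert_of_notMem (fun h ↦ hsT h.1) hTf.sdiff, ncard_sdiff_singleton_of_mem ht]
        omega
      intro I hI
      by_cases hsI : s ∈ I
      · have hI' : I \ {s} ⊆ T \ {t} := fun x hx ↦ (hI hx.1).resolve_left hx.2
        have hIf : I.Finite := (hTf.sdiff.insert s).subset hI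
        have htI : t ∉ I \ {s} := fun h ↦ (hI' h).2 rfl
        have h1 := hr (insert t (I \ {s})) (insert_subset ht (hI'.trans sdiff_subset))
        rw [ncard_insert_of_notMem htI hIf.sdiff, ncard_sdiff_singleton_of_mem hsI] at h1
        have h2 := ncard_pos hIf |>.2 ⟨s, hsI⟩
        have h3 : nrk M (C ∪ insert t (I \ {s})) = nrk M (C ∪ I) := by
          rw [hswap (Y := C ∪ insert t (I \ {s})) hcS htS hct (Or.inl hcC)
              (Or.inr (mem_insert _ _)),
            hswap (Y := C ∪ I) hcS hsS hsc.symm (Or.inl hcC) (Or.inr hsI)]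
          congr 1
          ext x
          simp
          grind
        have h4 : nrk M (C ∪ I) = nrk M (C ∩ B ∪ I) + 1 := by
          conv_lhs => rw [hCeq]
          rw [insert_union, nrk_insert_off hcs]
          refine union_subset (inter_subset_right.trans (subset_insert _ _)) fun x hx ↦ ?_
          by_cases hxs : x = s
          · exact Or.inl hxs
          · exact Or.inr ((hT' x (hI' ⟨hx, hxs⟩).1).resolve_left (hI' ⟨hx, hxs⟩).2)
        have h5 : I.ncard - 1 + 1 = I.ncard := by omega
        rw [h5] at h1
        omega
      · have hI' : I ⊆ T \ {t} := fun x hx ↦ (hI hx).resolve_left fun h ↦ hsI (h ▸ hx)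
        have := hmain I hI'
        have := hr I (hI'.trans sdiff_subset)
        omega
    have hg : GoodAt M (C ∩ B) (insert s (T \ {t})) := by
      rcases hk with rfl | rfl
      exacts [Or.inl hu, Or.inr hu]
    refine hM.not_goodAt (hL.subset_left hcS) hg (fun h ↦ hL.disj c hcS h.2) ?_ h hcC
    rintro (h | h)
    exacts [hsc h.symm, disjoint_left.1 hd hcC h.1]

lemma exists_maximal_skew {W : Set α} (hW : W ⊆ M.E) (hC : C ⊆ W)
    (h1 : nrk M C + 2 ≤ nrk M (C ∪ S)) (h2 : nrk M (W ∪ S) ≤ nrk M W + 1) :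
    ∃ C' b, C ⊆ C' ∧ C' ⊆ W ∧ b ∈ W ∧ b ∉ C' ∧ nrk M C' + 2 ≤ nrk M (C' ∪ S) ∧
      nrk M (insert b C' ∪ S) ≤ nrk M (insert b C') + 1 := by
  have hf : {X | X ⊆ W ∧ nrk M X + 2 ≤ nrk M (X ∪ S)}.Finite :=
    (M.set_finite W hW).finite_subsets.subset fun X h ↦ h.1
  obtain ⟨C', hCC', hmax⟩ := hf.exists_le_maximal (a := C) ⟨hC, h1⟩
  obtain ⟨b, hbW, hbC⟩ : ∃ b ∈ W, b ∉ C' := by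
    by_contra! hcon
    have := hmax.prop.2
    rw [hmax.prop.1.antisymm hcon] at this
    omega
  refine ⟨C', b, hCC', hmax.prop.1, hbW, hbC, hmax.prop.2, ?_⟩
  by_contra! hcon
  exact hbC (hmax.le_of_ge (y := insert b C') ⟨insert_subset hbW hmax.prop.1, by omega⟩
    (subset_insert _ _) (mem_insert _ _))

/-- If every element of the four-element set `S` is a coloop relative to `B`, then `S` together
with one element of `W ⊆ B` is the ground set of a `U_{2,5}`-minor. -/
lemma exists_goodAt_of_skew (hL : LineSep M S B) (hS : S.ncard = 4)
    (hoff : ∀ s ∈ S, nrk M B + 1 ≤ nrk M (insert s B)) {W : Set α} (hW : W ⊆ B) (hC : C ⊆ W)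
    (h1 : nrk M C + 2 ≤ nrk M (C ∪ S)) (h2 : nrk M (W ∪ S) ≤ nrk M W + 1) :
    ∃ C' T, GoodAt M C' T ∧ C ⊆ C' ∧ C' ⊆ W ∧ T ⊆ W ∪ S := by
  obtain ⟨C', b, hCC', hC'W, hbW, hbC', h3, h4⟩ :=
    exists_maximal_skew (hW.trans hL.subset_right) hC h1 h2
  have hSf := M.set_finite S hL.subset_left
  have hbS : b ∉ S := fun h ↦ hL.disj b h (hW hbW)
  have h5 := nrk_le_add_singleton (M := M) (U := insert b C') (X := C') subset_rfl
  have h6 := nrk_mono (M := M) (X := C' ∪ S) (Y := insert b C' ∪ S)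
    (union_subset_union_left _ (subset_insert _ _))
  have h7 : nrk M (C' ∪ S) ≤ nrk M C' + 2 := by
    have := nrk_submod (M := M) (U := C' ∪ S) (X := C') (Y := S) (I := ∅) subset_rfl
      (empty_subset _) (empty_subset _)
    have := hL.nrk_le
    omega
  have hbCW : insert b C' ⊆ B := insert_subset (hW hbW) (hC'W.trans hW)
  refine ⟨C', insert b S, Or.inl ⟨(hC'W.trans hW).trans hL.subset_right,
    insert_subset (hL.subset_right (hW hbW)) hL.subset_left, ?_, ?_, fun I hI ↦ ?_⟩, hCC', hC'W,
    insert_subset (Or.inl hbW) subset_union_right⟩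
  · exact disjoint_insert_right.2
      ⟨hbC', disjoint_right.2 fun x hx hx' ↦ hL.disj x hx (hW (hC'W hx'))⟩
  · rw [ncard_insert_of_notMem hbS hSf, hS]
  have hIf : I.Finite := (hSf.insert b).subset hI
  have hup := nrk_mono (M := M) (X := C' ∪ I) (Y := insert b C' ∪ S) fun x ↦ by
    have := @hI x
    simp at this ⊢
    tauto
  rcases I.eq_empty_or_nonempty with rfl | hne
  · simp
  have hpos := (ncard_pos hIf).2 hne
  by_cases hex : ∃ s ∈ I, s ∈ S
  · obtain ⟨s, hsI, hsS⟩ := hex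
    by_cases hex2 : ∃ d ∈ I, d ≠ s
    · obtain ⟨d, hdI, hds⟩ := hex2
      have hcard : 2 ≤ I.ncard := (one_lt_ncard hIf).2 ⟨d, hdI, s, hsI, hds⟩
      rw [min_eq_right hcard]
      refine le_antisymm (by omega) ?_
      rcases hI hdI with rfl | hdS
      · have := nrk_add_one_le_of_subset (hoff s hsS) hbCW
        have := nrk_mono (M := M) (X := insert s (insert d C')) (Y := C' ∪ I) (by
          intro x; simp; rintro (rfl | rfl | h) <;> tauto)
        omega
      · have := hL.nrk_union_le hdS hsS hds (U := C' ∪ S) (Y := C' ∪ I) (Or.inr hdI)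
          (Or.inr hsI) (by intro x; simp; tauto)
        omega
    · push Not at hex2
      obtain rfl : I = {s} := (eq_singleton_iff_unique_mem).2 ⟨hsI, hex2⟩
      rw [union_singleton, nrk_insert_off (hoff s hsS) (hC'W.trans hW)]
      simp
  · push Not at hex
    obtain rfl : I = {b} := by
      refine hne.subset_singleton_iff.1 fun x hx ↦ (hI hx).resolve_right (hex x hx)
    rw [union_singleton, ncard_singleton]
    omega

/-- Deleting an element of `B` lowers the connectivity to `S`, or the element lies on the
line `S`. -/
lemma free_or_mem_line (hL : LineSep M S B) (hM : FragileU25U35 M) (hS : S.ncard = 4)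
    (hoff : ∀ s ∈ S, nrk M B + 1 ≤ nrk M (insert s B))
    (hE : nrk M M.E ≤ nrk M B + 1) (he : e ∈ B) :
    nrk M (B \ {e}) + 2 ≤ nrk M (B \ {e} ∪ S) ∨ nrk M (insert e S) ≤ nrk M {e} + 1 := by
  by_contra! hcon
  obtain ⟨c, hc, d, hd, hcd⟩ := (one_lt_ncard (M.set_finite S hL.subset_left)).1
    (show 1 < S.ncard by omega)
  have hS2 : 2 ≤ nrk M S :=
    (hL.pair c hc d hd hcd).trans (nrk_mono (by intro x; simp; rintro (rfl | rfl) <;> assumption))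
  have hBS : nrk M (B ∪ S) ≤ nrk M B + 1 := by rwa [union_comm, hL.union_eq]
  obtain ⟨C₁, T₁, hg₁, -, hC₁, hT₁⟩ := hL.exists_goodAt_of_skew hS hoff (C := ∅)
    (W := B \ {e}) sdiff_subset (empty_subset _) (by simpa [nrk_empty]) (by omega)
  obtain ⟨C₂, T₂, hg₂, hC₂, -, -⟩ := hL.exists_goodAt_of_skew hS hoff (C := {e})
    (W := B) subset_rfl (by simpa) (by rw [singleton_union]; omega) hBS
  refine hM.not_goodAt (hL.subset_right he) hg₁ (fun h ↦ (hC₁ h).2 rfl) (fun h ↦ ?_) hg₂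
    (hC₂ rfl)
  rcases hT₁ h with h | h
  exacts [h.2 rfl, hL.disj e h he]

lemma ground_le_of_subset (hL : LineSep M S B) (hS : S.ncard = 4) (h : GoodAt M C T)
    (hST : S ⊆ T) : nrk M M.E ≤ nrk M B + 1 := by
  obtain ⟨k, hk, hC, hT, hd, h5, hr⟩ := h.exists_unifAt
  obtain ⟨b, hbT, hbS⟩ : ∃ b ∈ T, b ∉ S :=
    exists_mem_notMem_of_ncard_lt_ncard (by omega) (M.set_finite S hL.subset_left)
  have hC' : C ∪ {b} ⊆ B := union_subset
    (fun x hx ↦ (hL.mem_ground_iff.1 (hC hx)).resolve_left fun h ↦ disjoint_left.1 hd hx (hST h))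
    (singleton_subset_iff.2 ((hL.mem_ground_iff.1 (hT hbT)).resolve_left hbS))
  have h1 := nrk_submod (M := M) (U := M.E) (X := B) (Y := C ∪ {b} ∪ S) (I := C ∪ {b})
    (by rw [← hL.union_eq]; intro x; simp; tauto) hC' subset_union_left
  have h2 := nrk_submod (M := M) (U := C ∪ S) (X := C) (Y := S) (I := ∅) subset_rfl
    (empty_subset _) (empty_subset _)
  have h3 := hL.nrk_le
  have h4 := hr {b} (singleton_subset_iff.2 hbT)
  have h6 := hr S hST
  have h7 := hr (insert b S) (insert_subset hbT hST)
  rw [insert_eq, ← union_assoc, ncard_union_eq (by simpa) (toFinite _)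
    (M.set_finite S hL.subset_left), ncard_singleton, hS] at h7
  rw [ncard_singleton] at h4
  rw [hS] at h6
  rcases hk with rfl | rfl <;> omega

lemma parallelClass_right (hL : LineSep M S B) (hne : B.Nonempty) (hcard : 2 ≤ S.ncard)
    (hoff : ∀ s ∈ S, nrk M B + 1 ≤ nrk M (insert s B))
    (hline : ∀ e ∈ B, nrk M (insert e S) ≤ nrk M {e} + 1) : ParallelClass M B := by
  obtain ⟨c, hc, d, hd, hcd⟩ := (one_lt_ncard (M.set_finite S hL.subset_left)).1 hcard
  have hS2 : 2 ≤ nrk M S :=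
    (hL.pair c hc d hd hcd).trans (nrk_mono (by intro x; simp; rintro (rfl | rfl) <;> assumption))
  have h1 : ∀ e ∈ B, nrk M {e} = 1 := fun e he ↦ by
    have := hline e he
    have := nrk_singleton_le M e
    have := nrk_mono (M := M) (subset_insert e S)
    omega
  refine parallelClass_of_nrk hL.subset_right hne h1 (fun e he f hf hef ↦ ?_) fun e he s hs ↦ ?_
  · have h2 := nrk_submod (M := M) (U := insert e (insert f S)) (X := insert e S)
      (Y := insert f S) (I := S) (by intro x; simp; tauto) (subset_insert _ _) (subset_insert _ _)
    have h3 := nrk_submod (M := M) (U := M.E) (X := insert e (insert f S)) (Y := B) (I := {e, f})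
      (by rw [← hL.union_eq]; intro x; simp; tauto) (by intro x; simp; tauto)
      (by intro x; simp; rintro (rfl | rfl) <;> assumption)
    have := hline e he
    have := hline f hf
    have := h1 e he
    have := h1 f hf
    have := hL.sep
    omega
  · have hsS : s ∈ S := (hL.mem_ground_iff.1 hs.1).resolve_right hs.2
    have := nrk_add_one_le_of_subset (hoff s hsS) (singleton_subset_iff.2 he)
    have := h1 e he
    omega

lemma seriesClass_right (hL : LineSep M S B) (hne : B.Nonempty) (hcard : 3 ≤ S.ncard)
    (hE : nrk M M.E ≤ nrk M B + 1)
    (hfree : ∀ e ∈ B, nrk M (B \ {e}) + 2 ≤ nrk M (B \ {e} ∪ S)) : SeriesClass M B := by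
  have hdual : ∀ X ⊆ M.E, nrk M✶ X + nrk M M.E = nrk M (M.E \ X) + X.ncard :=
    fun X hX ↦ nrk_dual hX
  have hB : ∀ e ∈ B, nrk M B ≤ nrk M (B \ {e}) + 1 := fun e he ↦
    nrk_le_add_singleton (e := e) (by rw [insert_sdiff_singleton]; exact subset_insert _ _)
  have hdel : ∀ e ∈ B, B \ {e} ∪ S = M.E \ {e} := fun e he ↦ by
    ext x
    have := hL.mem_ground_iff (x := x)
    have := hL.disj x
    simp
    grind
  have hco : ∀ e ∈ B, nrk M (M.E \ {e}) = nrk M M.E := fun e he ↦ by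
    have h1 := hfree e he
    have h2 := hB e he
    rw [hdel e he] at h1
    exact le_antisymm (nrk_mono sdiff_subset) (by omega)
  have hcol : ∀ e ∈ B, nrk M (B \ {e}) + 1 ≤ nrk M B := fun e he ↦ by
    have h1 := hfree e he
    rw [hdel e he, hco e he] at h1
    omega
  refine parallelClass_of_nrk (M := M✶) hL.subset_right hne (fun e he ↦ ?_)
    (fun e he f hf hef ↦ ?_) fun e he s hs ↦ ?_
  · have := hdual {e} (singleton_subset_iff.2 (hL.subset_right he))
    rw [hco e he, ncard_singleton] at this
    omega
  · have h1 := hdual {e, f} (by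
      intro x; simp; rintro (rfl | rfl); exacts [hL.subset_right he, hL.subset_right hf])
    have h2 := nrk_submod (M := M) (U := M.E \ {e, f}) (X := B \ {e, f}) (Y := S) (I := ∅)
      (by rw [← hL.union_eq]; intro x; simp; tauto) (empty_subset _) (empty_subset _)
    have h3 := nrk_submod (M := M) (U := B) (X := B \ {e}) (Y := B \ {f}) (I := B \ {e, f})
      (by intro x hx; simp [hx]; grind) (by intro x; simp; tauto) (by intro x; simp; tauto)
    have := hcol e he
    have := hcol f hf
    have := hL.nrk_le
    have := hL.sep
    rw [ncard_pair hef] at h1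
    omega
  · have hsS : s ∈ S := (hL.mem_ground_iff.1 hs.1).resolve_right hs.2
    have hse : s ≠ e := fun h ↦ hL.disj s hsS (h ▸ he)
    obtain ⟨c, hc, d, hd, hcd⟩ := (one_lt_ncard
      ((M.set_finite S hL.subset_left).sdiff (t := {s}))).1
      (show 1 < (S \ {s}).ncard by rw [ncard_sdiff_singleton_of_mem hsS]; omega)
    have hcB : c ≠ e := fun h ↦ hL.disj c hc.1 (h ▸ he)
    have hdB : d ≠ e := fun h ↦ hL.disj d hd.1 (h ▸ he)
    have h1 := hdual {s, e} (by
      intro x; simp; rintro (rfl | rfl); exacts [hs.1, hL.subset_right he])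
    have h2 := hL.nrk_union_le hc.1 hd.1 hcd (Y := M.E \ {s, e}) (U := M.E \ {e})
      ⟨hL.subset_left hc.1, by simpa [hcB] using hc.2⟩
      ⟨hL.subset_left hd.1, by simpa [hdB] using hd.2⟩
      (by intro x; simp; grind)
    rw [hco e he] at h2
    rw [ncard_pair hse] at h1
    omega

lemma seriesClass_or_parallelClass (hL : LineSep M S B) (hM : FragileU25U35 M)
    (hS : S.ncard = 3 ∨ S.ncard = 4) (hne : B.Nonempty) :
    SeriesClass M B ∨ ParallelClass M B := by
  have hSf := M.set_finite S hL.subset_left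
  obtain ⟨C, T, hg⟩ := hM.exists_goodAt
  obtain ⟨c, hc, d, hd, hcd⟩ := (one_lt_ncard hSf).1 (show 1 < S.ncard by omega)
  have hS2 : 2 ≤ nrk M S :=
    (hL.pair c hc d hd hcd).trans (nrk_mono (by intro x; simp; rintro (rfl | rfl) <;> assumption))
  have hSr := hL.nrk_le
  have hsep := hL.sep
  have hle := ncard_le_ncard (inter_subset_right : T ∩ S ⊆ S) hSf
  have hTf : (T ∩ S).Finite := hSf.subset inter_subset_right
  have h4 : 4 ≤ (T ∩ S).ncard := by
    refine (hg.ncard_inter hL.union_eq hL.disj (by omega)).resolve_left fun h1 ↦ ?_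
    rcases Nat.le_one_iff_eq_zero_or_eq_one.1 h1 with h0 | h0
    · rw [ncard_eq_zero hTf] at h0
      exact hL.not_goodAt_of_disjoint hM (by omega) hg fun x hx hx' ↦
        (h0 ▸ (⟨hx, hx'⟩ : x ∈ T ∩ S) : x ∈ (∅ : Set α))
    · obtain ⟨t, ht⟩ := ncard_eq_one.1 h0
      have htm : t ∈ T ∩ S := ht ▸ rfl
      exact hL.not_goodAt_of_inter_eq_singleton hM (by omega) hg htm.1 htm.2
        fun x hx hx' ↦ (ht ▸ (⟨hx, hx'⟩ : x ∈ T ∩ S) : x ∈ ({t} : Set α))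
  have hST : S ⊆ T := by
    rw [← eq_of_subset_of_ncard_le (inter_subset_right : T ∩ S ⊆ S) (by omega) hSf]
    exact inter_subset_left
  have hS4 : S.ncard = 4 := by omega
  have hE := hL.ground_le_of_subset hS4 hg hST
  have hoff : ∀ s ∈ S, nrk M B + 1 ≤ nrk M (insert s B) := fun s hs ↦ by
    by_contra! hlt
    have h1 := nrk_mono (M := M) (sdiff_subset : S \ {s} ⊆ S)
    have h2 := hg.ncard_inter (P := S \ {s}) (Q := insert s B)
      (by rw [← hL.union_eq]; ext x; simp; grind)
      (fun x hx h ↦ h.elim hx.2 (hL.disj x hx.1)) (by omega)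
    rw [inter_eq_self_of_subset_right (sdiff_subset.trans hST),
      ncard_sdiff_singleton_of_mem hs] at h2
    omega
  by_cases hex : ∃ e ∈ B, nrk M (insert e S) ≤ nrk M {e} + 1
  · obtain ⟨e, he, hel⟩ := hex
    refine Or.inr (hL.parallelClass_right hne (by omega) hoff fun f hf ↦ ?_)
    by_cases hfe : f = e
    · rwa [hfe]
    refine (hL.free_or_mem_line hM hS4 hoff hE hf).resolve_left fun h ↦ ?_
    have h1 := nrk_submod (M := M) (U := B \ {f} ∪ S) (X := B \ {f}) (Y := insert e S)
      (I := {e}) (by intro x; simp; tauto) (by simp [he, Ne.symm hfe]) (by simp)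
    omega
  · push Not at hex
    exact Or.inl (hL.seriesClass_right hne (by omega) hE fun e he ↦
      (hL.free_or_mem_line hM hS4 hoff hE he).resolve_right (hex e he).not_ge)

end LineSep

lemma Circuit.two_le_nrk (h : Circuit M C) (hC : C.ncard = 3) {x y : α} (hx : x ∈ C) (hy : y ∈ C)
    (hxy : x ≠ y) : 2 ≤ nrk M {x, y} := by
  have hsub : {x, y} ⊆ C := by intro z; simp; rintro (rfl | rfl) <;> assumption
  have h1 := h.2 {x, y} (hsub.ssubset_of_ne (by rintro rfl; rw [ncard_pair hxy] at hC; omega))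
  rw [indep_iff_nrk (toFinite _), ncard_pair hxy] at h1
  omega

lemma Circuit.nrk_le_two (h : Circuit M C) (hC : C.ncard = 3) : nrk M C ≤ 2 := by
  have hf : C.Finite := finite_of_ncard_pos (by omega)
  have h1 := h.1.not_indep
  rw [indep_iff_nrk hf] at h1
  have := nrk_le_ncard (M := M) hf
  omega

lemma nrk_le_two_and_pair (h : Triangle M X ∨ (Segment M X ∧ X.ncard = 4)) :
    nrk M X ≤ 2 ∧ ∀ x ∈ X, ∀ y ∈ X, x ≠ y → 2 ≤ nrk M {x, y} := by
  rcases h with ⟨hc, h3⟩ | ⟨⟨hXE, hseg⟩, h4⟩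
  · exact ⟨hc.nrk_le_two h3, fun x hx y hy hxy ↦ hc.two_le_nrk h3 hx hy hxy⟩
  have hf := M.set_finite X hXE
  have htri : ∀ x ∈ X, (X \ {x}).ncard = 3 ∧ Circuit M (X \ {x}) := fun x hx ↦ by
    have : (X \ {x}).ncard = 3 := by rw [ncard_sdiff_singleton_of_mem hx]; omega
    exact ⟨this, hseg _ sdiff_subset this⟩
  have hpair : ∀ x ∈ X, ∀ y ∈ X, x ≠ y → 2 ≤ nrk M {x, y} := fun x hx y hy hxy ↦ by
    obtain ⟨z, hz, hzxy⟩ : ∃ z ∈ X, z ∉ ({x, y} : Set α) :=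
      exists_mem_notMem_of_ncard_lt_ncard (by rw [ncard_pair hxy]; omega) (toFinite _)
    simp only [mem_insert_iff, mem_singleton_iff, not_or] at hzxy
    obtain ⟨h3, hc⟩ := htri z hz
    exact hc.two_le_nrk h3 ⟨hx, Ne.symm hzxy.1⟩ ⟨hy, Ne.symm hzxy.2⟩ hxy
  refine ⟨?_, hpair⟩
  obtain ⟨x, hx, y, hy, hxy⟩ := (one_lt_ncard hf).1 (show 1 < X.ncard by omega)
  have h1 := nrk_submod (M := M) (U := X) (X := X \ {x}) (Y := X \ {y}) (I := X \ {x, y})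
    (by intro z hz; simp [hz]; grind) (by intro z; simp; tauto) (by intro z; simp; tauto)
  have h2 := (htri x hx).2.nrk_le_two (htri x hx).1
  have h3 := (htri y hy).2.nrk_le_two (htri y hy).1
  have h5 : ((X \ {x}) \ {y}).ncard = 2 := by
    rw [ncard_sdiff_singleton_of_mem (show y ∈ X \ {x} from ⟨hy, hxy.symm⟩), (htri x hx).1]
  obtain ⟨a, b, hab, hXab⟩ := ncard_eq_two.1 h5
  have hXxy : X \ {x, y} = {a, b} := by rw [← hXab]; ext z; simp; tauto
  have hsub : ({a, b} : Set α) ⊆ X := hXxy ▸ sdiff_subset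
  have h6 := hpair a (hsub (by simp)) b (hsub (by simp)) hab
  rw [hXxy] at h1
  omega

lemma FragileU25U35.dual_indep (hM : FragileU25U35 M) (hcard : 8 ≤ M.E.ncard)
    (hX : Triangle M X ∨ (Segment M X ∧ X.ncard = 4)) (hs : ¬ SeriesClass M (M.E \ X))
    (hp : ¬ ParallelClass M (M.E \ X)) : M✶.Indep X := by
  by_contra hcon
  have hXE : X ⊆ M.E := hX.elim (fun h ↦ h.1.1.subset_ground) fun h ↦ h.1.1
  have hXf := M.set_finite X hXE
  have hX3 : X.ncard = 3 ∨ X.ncard = 4 := hX.imp And.right And.right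
  have hE := nrk_dual hXE
  have hle := nrk_le_ncard (M := M✶) hXf
  rw [indep_iff_nrk hXf] at hcon
  have hL : LineSep M X (M.E \ X) :=
    ⟨union_sdiff_cancel hXE, fun x hx h ↦ h.2 hx, (nrk_le_two_and_pair hX).1,
      (nrk_le_two_and_pair hX).2, by omega⟩
  have hne : (M.E \ X).Nonempty := by
    rw [sdiff_nonempty]
    intro h
    have := ncard_le_ncard h hXf
    omega
  exact (hL.seriesClass_or_parallelClass hM hX3 hne).elim hs hp

lemma UnifAt.hasUnifMinor (h : UnifAt M C T k) : HasUnifMinor M k 5 :=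
  ⟨_, ⟨C, M.E \ (C ∪ T), h.1, sdiff_subset,
    disjoint_left.2 fun _ hx hx' ↦ hx'.2 (Or.inl hx), rfl⟩, h.isUniform⟩

lemma UnifAt.dual (h : UnifAt M C T k) (hk : k ≤ 5) :
    UnifAt M✶ (M.E \ (C ∪ T)) T (5 - k) := by
  obtain ⟨hC, hT, hd, h5, hr⟩ := h
  have hTf := M.set_finite T hT
  have hdT : Disjoint (M.E \ (C ∪ T)) T := disjoint_left.2 fun x hx hx' ↦ hx.2 (Or.inr hx')
  have hdual : ∀ I ⊆ T, nrk M✶ (M.E \ (C ∪ T) ∪ I) + nrk M M.E =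
      nrk M C + min (5 - I.ncard) k + ((M.E \ (C ∪ T)).ncard + I.ncard) := fun I hI ↦ by
    have hIf := hTf.subset hI
    have h1 := nrk_dual (M := M) (X := M.E \ (C ∪ T) ∪ I)
      (union_subset sdiff_subset (hI.trans hT))
    have h2 : M.E \ (M.E \ (C ∪ T) ∪ I) = C ∪ (T \ I) := by
      ext x
      have := @hC x
      have := @hT x
      have := @hI x
      have : x ∈ C → x ∉ T := fun h ↦ disjoint_left.1 hd h
      simp
      tauto
    rw [h2, hr _ sdiff_subset, ncard_sdiff hI hIf, h5,
      ncard_union_eq (hdT.mono_right hI) (M.set_finite _ sdiff_subset) hIf] at h1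
    exact h1
  refine ⟨sdiff_subset, hT, hdT, h5, fun I hI ↦ ?_⟩
  have h1 := hdual I hI
  have h2 := hdual ∅ (empty_subset _)
  have h3 := ncard_le_ncard hI hTf
  rw [union_empty, ncard_empty] at h2
  omega

lemma HasU25U35Minor.dual (h : HasU25U35Minor M) : HasU25U35Minor M✶ := by
  rcases h with h | h
  · obtain ⟨C, T, h⟩ := h.exists_unifAt
    exact Or.inr (h.dual (by omega)).hasUnifMinor
  · obtain ⟨C, T, h⟩ := h.exists_unifAt
    exact Or.inl (h.dual (by omega)).hasUnifMinor

lemma FragileU25U35.dual (h : FragileU25U35 M) : FragileU25U35 M✶ := by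
  refine ⟨h.1.dual, fun a ha ⟨h1, h2⟩ ↦ h.2 a ha ⟨?_, ?_⟩⟩
  · have : (contract M✶ {a}).Finite := ⟨M.ground_finite.subset sdiff_subset⟩
    have h3 := h2.dual
    rwa [contract, dual_dual, dual_dual] at h3
  · have : (delete M✶ {a}).Finite := ⟨M.ground_finite.subset sdiff_subset⟩
    exact h1.dual

end Rank

end Relax

/-- Let `M` be a `{U_{2,5}, U_{3,5}}`-fragile (finite) matroid with at least
8 elements. If `S` is a triangle or a 4-element segment of `M` such that `E(M) − S` is not a
series class or a parallel class of `M`, then `S` is coindependent in `M`. Dually, if `C` is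
a triad or a 4-element cosegment of `M` such that `E(M) − C` is not a series or parallel
class of `M`, then `C` is independent in `M`. -/
theorem statement9 {α : Type*} (M : Matroid α)
    (hfin : M.E.Finite)
    (hfrag : Relax.FragileU25U35 M) (hcard : 8 ≤ M.E.ncard) :
    (∀ S, (Relax.Triangle M S ∨ (Relax.Segment M S ∧ S.ncard = 4)) →
      ¬ Relax.SeriesClass M (M.E \ S) → ¬ Relax.ParallelClass M (M.E \ S) →
        M✶.Indep S) ∧
    (∀ C, (Relax.Triangle M✶ C ∨ (Relax.Segment M✶ C ∧ C.ncard = 4)) →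
      ¬ Relax.SeriesClass M (M.E \ C) → ¬ Relax.ParallelClass M (M.E \ C) →
        M.Indep C) := by
  have : M.Finite := ⟨hfin⟩
  refine ⟨fun S hS hs hp ↦ hfrag.dual_indep hcard hS hs hp, fun C hC hs hp ↦ ?_⟩
  have h := hfrag.dual.dual_indep hcard hC (fun h ↦ hp ?_) hs
  · rwa [dual_dual] at h
  · rwa [Relax.SeriesClass, dual_dual] at h
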